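/- Let A be a finite-dimensional central simple algebra over a field F and g ∈ A an element whose minimal polynomial over F is separable of degree equal to the degree of the reduced characteristic polynomial of g (i.e. g is regular semisimple). Then the F-subalgebra F[g] generated by g equals the centralizer of g in A, and F[g] is a maximal commutative subalgebra of A. -/

import Mathlib

open TensorProduct

section CentralSimple

variable {F A : Type*} [Field F] [Ring A] [Algebra F A]

/-- In a central simple algebra, two-sided multiplication operators `x ↦ ∑ i, a i * x * b i` with
`b` linearly independent vanish only if all the left coefficients vanish. -/
theorem LinearIndependent.eq_zero_of_sum_mul_mul_eq_zero [Algebra.IsCentral F A] [IsSimpleRing A]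
    {ι : Type*} {b : ι → A} (hb : LinearIndependent F b) (s : Finset ι) :
    ∀ a : ι → A, (∀ x, ∑ i ∈ s, a i * x * b i = 0) → ∀ i ∈ s, a i = 0 := by
  classical
  induction s using Finset.induction_on with
  | empty => simp
  | insert j t hj ih =>
    intro a ha
    have key : a j = 0 := by
      by_contra hne
      let I : TwoSidedIdeal A := TwoSidedIdeal.mk'
        {c | ∃ a' : ι → A, a' j = c ∧ ∀ x, ∑ i ∈ insert j t, a' i * x * b i = 0}
        ⟨0, by simp⟩
        (by
          rintro _ _ ⟨u, rfl, hu⟩ ⟨v, rfl, hv⟩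
          refine ⟨u + v, rfl, fun x => ?_⟩
          simp only [Pi.add_apply, add_mul, Finset.sum_add_distrib, hu, hv, add_zero])
        (by
          rintro _ ⟨u, rfl, hu⟩
          refine ⟨-u, rfl, fun x => ?_⟩
          simp only [Pi.neg_apply, neg_mul, Finset.sum_neg_distrib, hu, neg_zero])
        (by
          rintro x _ ⟨u, rfl, hu⟩
          refine ⟨fun i => x * u i, rfl, fun z => ?_⟩
          simpa only [Finset.mul_sum, mul_assoc, mul_zero] using congrArg (x * ·) (hu z))
        (by
          rintro _ y ⟨u, rfl, hu⟩
          refine ⟨fun i => u i * y, rfl, fun z => ?_⟩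
          simpa only [mul_assoc] using hu (y * z))
      have hmem : a j ∈ I := (TwoSidedIdeal.mem_mk' ..).2 ⟨a, rfl, ha⟩
      obtain ⟨u, hu1, hu⟩ :=
        (TwoSidedIdeal.mem_mk' ..).1 (IsSimpleRing.one_mem_of_ne_zero_mem I hne hmem)
      have hcomm : ∀ y, ∀ i ∈ insert j t, y * u i - u i * y = 0 := by
        intro y
        have hj0 : y * u j - u j * y = 0 := by rw [hu1, mul_one, one_mul, sub_self]
        have ht := ih (fun i => y * u i - u i * y) fun x => by
          have h1 : ∑ i ∈ insert j t, (y * u i - u i * y) * x * b i = 0 := by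
            have h2 := congrArg (y * ·) (hu x)
            have h3 := hu (y * x)
            simp only [Finset.mul_sum, mul_zero] at h2
            simp only [sub_mul, Finset.sum_sub_distrib]
            simp only [mul_assoc] at h2 h3 ⊢
            rw [h2, h3, sub_zero]
          rwa [Finset.sum_insert hj, hj0, zero_mul, zero_mul, zero_add] at h1
        intro i hi
        rcases Finset.mem_insert.1 hi with rfl | hi
        · exact hj0
        · exact ht i hi
      have hscalar : ∀ i ∈ insert j t, ∃ c : F, algebraMap F A c = u i := fun i hi =>
        Algebra.mem_bot.1 (Algebra.IsCentral.out
          (Subalgebra.mem_center_iff.2 fun y => sub_eq_zero.1 (hcomm y i hi)))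
      choose! c hc using hscalar
      have hsum : ∑ i ∈ insert j t, c i • b i = 0 := by
        rw [← hu 1]
        exact Finset.sum_congr rfl fun i hi => by rw [← hc i hi, mul_one, Algebra.smul_def]
      have hcj := linearIndependent_iff'.1 hb _ c hsum j (Finset.mem_insert_self j t)
      have := hc j (Finset.mem_insert_self j t)
      rw [hcj, hu1, map_zero] at this
      exact zero_ne_one this
    intro i hi
    rcases Finset.mem_insert.1 hi with rfl | hi
    · exact key
    · exact ih a (fun x => by simpa [Finset.sum_insert hj, key] using ha x) i hi

theorem AlgHom.mulLeftRight_injective [Algebra.IsCentral F A] [IsSimpleRing A] :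
    Function.Injective (AlgHom.mulLeftRight F A) := by
  refine (injective_iff_map_eq_zero _).2 fun t ht => ?_
  let b := Module.Basis.ofVectorSpace F A
  obtain ⟨a, rfl⟩ := TensorProduct.eq_repr_basis_right (b.map (MulOpposite.opLinearEquiv F)) t
  have h := b.linearIndependent.eq_zero_of_sum_mul_mul_eq_zero a.support a fun x => by
    simpa [Finsupp.sum, LinearMap.sum_apply] using LinearMap.congr_fun ht x
  exact Finset.sum_eq_zero fun i hi => by simp only [h i hi, zero_tmul]

end CentralSimple

/-- A faithful representation of a commutative semisimple ring has a vector with trivial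
annihilator. -/
theorem IsSemisimpleRing.exists_forall_apply_eq_zero {R S M : Type*} [CommRing R]
    [IsSemisimpleRing R] [CommRing S] [AddCommGroup M] [Module S M]
    (φ : R →+* Module.End S M) (hφ : Function.Injective φ) :
    ∃ v : M, ∀ r, φ r v = 0 → r = 0 := by
  let ann (v : M) : Ideal R :=
    { carrier := {r | φ r v = 0}
      add_mem' := fun {x y} hx hy => by
        simp only [Set.mem_ofPred_eq] at hx hy ⊢
        rw [map_add, LinearMap.add_apply, hx, hy, add_zero]
      zero_mem' := by simp
      smul_mem' := fun c x hx => by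
        simp only [Set.mem_ofPred_eq] at hx ⊢
        rw [smul_eq_mul, map_mul, Module.End.mul_apply, hx, map_zero] }
  obtain ⟨_, ⟨v, rfl⟩, hmin⟩ := set_has_minimal_iff_artinian.2 (inferInstance : IsArtinian R R)
    (Set.range ann) ⟨_, 0, rfl⟩
  refine ⟨v, fun r hr => ?_⟩
  obtain ⟨e, he, hspan⟩ := IsSemisimpleRing.ideal_eq_span_idempotent (ann v)
  have hev : φ e v = 0 := (hspan ▸ Ideal.mem_span_singleton_self e : e ∈ ann v)
  by_cases he0 : e = 0
  · have hr' : r ∈ ann v := hr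
    simpa [hspan, he0] using hr'
  obtain ⟨x, hx⟩ : ∃ x, φ e x ≠ 0 := by
    by_contra! h
    exact he0 (hφ (by rw [map_zero]; exact LinearMap.ext h))
  have hee (y : M) : φ e (φ e y) = φ e y := by rw [← Module.End.mul_apply, ← map_mul, he.eq]
  have hcomm (s : R) (y : M) : φ e (φ s y) = φ s (φ e y) := by
    rw [← Module.End.mul_apply, ← Module.End.mul_apply, ← map_mul, ← map_mul, mul_comm]
  refine (hmin _ ⟨v + φ e x, rfl⟩ (lt_of_le_of_ne (fun s hs => ?_) fun heq => ?_)).elim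
  · have hs : φ s (v + φ e x) = 0 := hs
    have h1 : φ s (φ e x) = 0 := by
      have := congrArg (φ e) hs
      rwa [hcomm, map_add, hev, hee, zero_add, map_zero] at this
    rw [map_add, h1, add_zero] at hs
    exact hs
  · have : e ∈ ann (v + φ e x) := heq ▸ hev
    have : φ e (v + φ e x) = 0 := this
    rw [map_add, hev, hee, zero_add] at this
    exact hx this

theorem AdjoinRoot.formallyUnramified_of_separable {R : Type*} [CommRing R] {f : Polynomial R}
    (hf : f.Separable) : Algebra.FormallyUnramified R (AdjoinRoot f) := by
  rw [Algebra.FormallyUnramified.iff_comp_injective]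
  intro B _ _ I hI f₁ f₂ e
  apply AdjoinRoot.algHom_ext
  set x := AdjoinRoot.root f with hx
  have hroot : Polynomial.aeval x f = 0 := by rw [hx, AdjoinRoot.aeval_eq, AdjoinRoot.mk_self]
  have hunit : IsUnit (Polynomial.aeval x f.derivative) := by
    obtain ⟨a, b, hab⟩ := hf
    have := congrArg (Polynomial.aeval x) hab
    rw [map_add, map_mul, map_mul, hroot, mul_zero, zero_add, map_one] at this
    exact .of_mul_eq_one_right _ this
  have : f₁ x - f₂ x ∈ I := by
    simpa [Ideal.Quotient.mk_eq_mk_iff_sub_mem] using AlgHom.congr_fun e x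
  have := Polynomial.eval_add_of_sq_eq_zero (f.map (algebraMap R B)) (f₂ x)
    (f₁ x - f₂ x) (show (f₁ x - f₂ x) ^ 2 ∈ (⊥ : Ideal B) from hI ▸ Ideal.pow_mem_pow this 2)
  simp only [add_sub_cancel, Polynomial.eval_map_algebraMap, Polynomial.aeval_algHom_apply, hroot,
    map_zero, Polynomial.derivative_map, zero_add] at this
  rwa [eq_comm, (hunit.map f₂).mul_right_eq_zero, sub_eq_zero] at this

/-- The annihilator of `x ⊗ 1 - 1 ⊗ x` in `F[x] ⊗ F[x]` has dimension at most that of `F[x]`. -/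
theorem AdjoinRoot.finrank_ker_mulLeft_le {F : Type*} [Field F] {f : Polynomial F} (hf : f ≠ 0) :
    Module.finrank F (LinearMap.mulLeft F
      (AdjoinRoot.root f ⊗ₜ[F] 1 - 1 ⊗ₜ[F] AdjoinRoot.root f)).ker ≤ f.natDegree := by
  have : Module.Finite F (AdjoinRoot f) := (AdjoinRoot.powerBasis hf).finite
  have hdim : Module.finrank F (AdjoinRoot f) = f.natDegree := finrank_quotient_span_eq_natDegree
  set δ := AdjoinRoot.root f ⊗ₜ[F] (1 : AdjoinRoot f) - 1 ⊗ₜ[F] AdjoinRoot.root f with hδ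
  have hq : ((Ideal.Quotient.mkₐ F (Ideal.span {δ})).comp
      Algebra.TensorProduct.includeRight : AdjoinRoot f →ₐ[F] _) =
      (Ideal.Quotient.mkₐ F (Ideal.span {δ})).comp Algebra.TensorProduct.includeLeft := by
    apply AdjoinRoot.algHom_ext
    refine (Ideal.Quotient.eq.2 ?_).symm
    exact Ideal.mem_span_singleton_self δ
  have hcover : (LinearMap.mulLeft F δ).range ⊔
      (Algebra.TensorProduct.includeLeft : AdjoinRoot f →ₐ[F] AdjoinRoot f ⊗[F] AdjoinRoot f
        ).toLinearMap.range = ⊤ := by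
    refine eq_top_iff.2 fun t _ => ?_
    induction t using TensorProduct.induction_on with
    | zero => exact zero_mem _
    | add x y hx hy => exact add_mem (hx trivial) (hy trivial)
    | tmul a b =>
      have h := Ideal.mem_span_singleton'.1 (Ideal.Quotient.eq.1 (AlgHom.congr_fun hq b))
      obtain ⟨c, hc⟩ := h
      refine Submodule.mem_sup.2 ⟨δ * (a ⊗ₜ 1 * c), ⟨_, rfl⟩, (a * b) ⊗ₜ 1, ⟨a * b, rfl⟩, ?_⟩
      have hc' : c * δ = 1 ⊗ₜ b - b ⊗ₜ 1 := hc
      rw [show δ * (a ⊗ₜ 1 * c) = a ⊗ₜ 1 * (c * δ) by ring, hc', mul_sub]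
      simp
  have h1 := (LinearMap.mulLeft F δ).finrank_range_add_finrank_ker
  have h2 := Submodule.finrank_add_le_finrank_add_finrank (LinearMap.mulLeft F δ).range
    (Algebra.TensorProduct.includeLeft : AdjoinRoot f →ₐ[F] AdjoinRoot f ⊗[F] AdjoinRoot f
        ).toLinearMap.range
  rw [hcover, finrank_top] at h2
  have h3 := LinearMap.finrank_range_le
    (Algebra.TensorProduct.includeLeft : AdjoinRoot f →ₐ[F] AdjoinRoot f ⊗[F] AdjoinRoot f
        ).toLinearMap
  omega

section Embedding

variable {F A : Type*} [Field F] [Ring A] [Algebra F A]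

/-- The embedding of `F[x]/(minpoly F g)` into `A` sending `x` to `g`. -/
noncomputable def AdjoinRoot.minpolyHom (g : A) : AdjoinRoot (minpoly F g) →ₐ[F] A :=
  Ideal.Quotient.liftₐ (Ideal.span {minpoly F g}) (Polynomial.aeval g) fun p hp => by
    obtain ⟨q, rfl⟩ := Ideal.mem_span_singleton.1 hp
    rw [map_mul, minpoly.aeval, zero_mul]

theorem AdjoinRoot.minpolyHom_root (g : A) :
    AdjoinRoot.minpolyHom g (AdjoinRoot.root (minpoly F g)) = g :=
  Polynomial.aeval_X g

theorem AdjoinRoot.minpolyHom_injective (g : A) :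
    Function.Injective (AdjoinRoot.minpolyHom (F := F) g) := by
  refine (injective_iff_map_eq_zero _).2 fun x hx => ?_
  obtain ⟨p, rfl⟩ := AdjoinRoot.mk_surjective x
  exact AdjoinRoot.mk_eq_zero.2 (minpoly.dvd F g hx)

/-- `F[g] ⊗ F[g]` acting on `A` by left and right multiplication. -/
noncomputable def AdjoinRoot.bimoduleHom (g : A) :
    AdjoinRoot (minpoly F g) ⊗[F] AdjoinRoot (minpoly F g) →ₐ[F] Module.End F A :=
  (AlgHom.mulLeftRight F A).comp <| Algebra.TensorProduct.map (AdjoinRoot.minpolyHom g)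
    ((AdjoinRoot.minpolyHom g).toOpposite fun x y => (Commute.all x y).map _)

theorem AdjoinRoot.bimoduleHom_tmul (g : A) (x y : AdjoinRoot (minpoly F g)) (a : A) :
    AdjoinRoot.bimoduleHom g (x ⊗ₜ[F] y) a =
      AdjoinRoot.minpolyHom g x * a * AdjoinRoot.minpolyHom g y := by
  simp [AdjoinRoot.bimoduleHom]

theorem AdjoinRoot.bimoduleHom_injective [Algebra.IsCentral F A] [IsSimpleRing A] (g : A) :
    Function.Injective (AdjoinRoot.bimoduleHom (F := F) g) :=
  AlgHom.mulLeftRight_injective.comp <|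
    TensorProduct.map_injective_of_flat_flat (AdjoinRoot.minpolyHom g).toLinearMap
      ((AdjoinRoot.minpolyHom g).toOpposite
        fun x y => (Commute.all x y).map (AdjoinRoot.minpolyHom (F := F) g)).toLinearMap
      (AdjoinRoot.minpolyHom_injective g)
      (MulOpposite.op_injective.comp (AdjoinRoot.minpolyHom_injective g))

/-- The centralizer of a regular semisimple element has dimension at most the degree of its
minimal polynomial. -/
theorem finrank_centralizer_le_natDegree_minpoly [FiniteDimensional F A] [Algebra.IsCentral F A]
    [IsSimpleRing A] (g : A) (hsep : (minpoly F g).Separable)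
    (hdeg : (minpoly F g).natDegree ^ 2 = Module.finrank F A) :
    Module.finrank F (Subalgebra.centralizer F {g}) ≤ (minpoly F g).natDegree := by
  have hf : minpoly F g ≠ 0 := minpoly.ne_zero (Algebra.IsIntegral.isIntegral g)
  let E := AdjoinRoot (minpoly F g)
  have : Module.Finite F E := (AdjoinRoot.powerBasis hf).finite
  have hdim : Module.finrank F E = (minpoly F g).natDegree := finrank_quotient_span_eq_natDegree
  have : Algebra.FormallyUnramified F E := AdjoinRoot.formallyUnramified_of_separable hsep
  have : Algebra.FormallyUnramified F (E ⊗[F] E) := .comp F E (E ⊗[F] E)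
  have : IsReduced (E ⊗[F] E) := Algebra.FormallyUnramified.isReduced_of_field F _
  have : IsArtinianRing (E ⊗[F] E) := .of_finite F _
  have : IsSemisimpleRing (E ⊗[F] E) := IsArtinianRing.isSemisimpleRing_of_isReduced _
  obtain ⟨v, hv⟩ := IsSemisimpleRing.exists_forall_apply_eq_zero
    (AdjoinRoot.bimoduleHom (F := F) g).toRingHom (AdjoinRoot.bimoduleHom_injective g)
  let L : E ⊗[F] E →ₗ[F] A := (LinearMap.applyₗ v).comp (AdjoinRoot.bimoduleHom g).toLinearMap
  have hL : Function.Surjective L := by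
    refine (LinearMap.injective_iff_surjective_of_finrank_eq_finrank ?_).1
      ((injective_iff_map_eq_zero L).2 hv)
    rw [Module.finrank_tensorProduct, hdim, ← hdeg, sq]
  set δ : E ⊗[F] E := AdjoinRoot.root _ ⊗ₜ[F] 1 - 1 ⊗ₜ[F] AdjoinRoot.root _ with hδ
  have hle : Subalgebra.toSubmodule (Subalgebra.centralizer F {g}) ≤
      (LinearMap.mulLeft F δ).ker.map L := by
    intro a ha
    have ha : g * a = a * g := Subalgebra.mem_centralizer_iff F |>.1 ha g rfl
    obtain ⟨r, rfl⟩ := hL a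
    refine ⟨r, hv _ ?_, rfl⟩
    have : AdjoinRoot.bimoduleHom g δ (L r) = 0 := by
      rw [hδ, map_sub, LinearMap.sub_apply, AdjoinRoot.bimoduleHom_tmul,
        AdjoinRoot.bimoduleHom_tmul, AdjoinRoot.minpolyHom_root, map_one, mul_one, one_mul, ha,
        sub_self]
    change AdjoinRoot.bimoduleHom g (δ * r) v = 0
    rw [map_mul]
    exact this
  calc Module.finrank F (Subalgebra.centralizer F {g})
      ≤ Module.finrank F ((LinearMap.mulLeft F δ).ker.map L) := Submodule.finrank_mono hle
    _ ≤ Module.finrank F (LinearMap.mulLeft F δ).ker := Submodule.finrank_map_le _ _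
    _ ≤ _ := AdjoinRoot.finrank_ker_mulLeft_le hf

theorem natDegree_minpoly_le_finrank_adjoin [FiniteDimensional F A] (g : A) :
    (minpoly F g).natDegree ≤ Module.finrank F (Algebra.adjoin F {g}) := by
  have hdim : Module.finrank F (AdjoinRoot (minpoly F g)) = (minpoly F g).natDegree :=
    finrank_quotient_span_eq_natDegree
  rw [← hdim, ← LinearMap.finrank_range_of_inj
    (f := (AdjoinRoot.minpolyHom (F := F) g).toLinearMap) (AdjoinRoot.minpolyHom_injective g)]
  refine Submodule.finrank_mono (t := Subalgebra.toSubmodule (Algebra.adjoin F {g})) ?_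
  rintro _ ⟨x, rfl⟩
  obtain ⟨p, rfl⟩ := AdjoinRoot.mk_surjective x
  exact Polynomial.aeval_mem_adjoin_singleton F g

end Embedding


/-- Let `A` be a finite-dimensional central simple algebra over a field `F` and `g ∈ A`
an element whose minimal polynomial over `F` is separable of degree equal to the degree
of the reduced characteristic polynomial, i.e. `(deg minpoly)² = dim_F A` (`g` is regular
semisimple).  Then the subalgebra `F[g]` generated by `g` equals the centralizer of `g`
in `A`, and `F[g]` is a maximal commutative subalgebra of `A`. -/
theorem stmt_3 {F A : Type*} [Field F] [Ring A] [Algebra F A] [FiniteDimensional F A]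
    [Algebra.IsCentral F A] [IsSimpleRing A]
    (g : A) (hsep : (minpoly F g).Separable)
    (hdeg : (minpoly F g).natDegree ^ 2 = Module.finrank F A) :
    Algebra.adjoin F {g} = Subalgebra.centralizer F {g} ∧
      (∀ a b, a ∈ Algebra.adjoin F {g} → b ∈ Algebra.adjoin F {g} → Commute a b) ∧
      ∀ a : A, (∀ b ∈ Algebra.adjoin F {g}, Commute a b) → a ∈ Algebra.adjoin F {g} := by
  have hle : Algebra.adjoin F {g} ≤ Subalgebra.centralizer F {g} :=
    Algebra.adjoin_le (Set.singleton_subset_iff.2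
      (Subalgebra.mem_centralizer_iff F |>.2 (by rintro _ rfl; rfl)))
  have heq : Algebra.adjoin F {g} = Subalgebra.centralizer F {g} :=
    Subalgebra.eq_of_le_of_finrank_le hle
      ((finrank_centralizer_le_natDegree_minpoly g hsep hdeg).trans
        (natDegree_minpoly_le_finrank_adjoin g))
  refine ⟨heq, fun a b ha hb => ?_, fun a ha => ?_⟩
  · exact Algebra.commute_of_mem_adjoin_singleton_of_commute hb
      (Subalgebra.mem_centralizer_iff F |>.1 (hle ha) g rfl).symm
  · rw [heq, Subalgebra.mem_centralizer_iff]
    rintro _ rfl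
    exact (ha _ (Algebra.self_mem_adjoin_singleton F _)).symm
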